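/- arXiv:2605.18079 — 8 statements merged into one kernel-verified Lean document; each statement's English description precedes it below -/
import Mathlib

section
/- Let s = (s_0,…,s_{n−1}) ∈ ℝ^n, let α = softmax(s), let J ⊆ {0,…,n−1} be nonempty, and let β = sep_J(s). Then Σ_{j∉J} α_j ≤ n·e^{−β}. -/
/-- The softmax of a vector of scores. -/
noncomputable def softmax {n : ℕ} (s : Fin n → ℝ) : Fin n → ℝ :=
  fun j => Real.exp (s j) / ∑ l, Real.exp (s l)

/-- A softmax weight is at most its ratio to any other softmax weight. -/
theorem softmax_le_exp_sub {n : ℕ} (s : Fin n → ℝ) (j k : Fin n) :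
    softmax s j ≤ Real.exp (s j - s k) := by
  rw [softmax, Real.exp_sub]
  gcongr
  exact Finset.single_le_sum (f := fun l => Real.exp (s l))
    (fun l _ => (Real.exp_pos (s l)).le) (Finset.mem_univ k)

/-- For a nonempty subset `J` of indices, the softmax mass outside `J` is bounded by
`n·e^{-β}` where `β = sep_J(s) = min_{j∈J} s_j − max_{j∉J} s_j` (with the maximum over
the empty set being `-∞`, in which case the mass outside `J` is `0`). -/
theorem softmax_mass_off_J (n : ℕ) (s : Fin n → ℝ) (J : Finset (Fin n)) (hJ : J.Nonempty) :
    ∑ j ∈ Jᶜ, softmax s j ≤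
      if h : (Jᶜ : Finset (Fin n)).Nonempty
      then (n : ℝ) * Real.exp (-(J.inf' hJ s - Jᶜ.sup' h s))
      else 0 := by
  split_ifs with h
  · obtain ⟨k, hk⟩ := hJ
    have bound : ∀ j ∈ Jᶜ,
        softmax s j ≤ Real.exp (-(J.inf' ⟨k, hk⟩ s - Jᶜ.sup' h s)) := by
      intro j hj
      have hinf := Finset.inf'_le s hk
      have hsup := Finset.le_sup' s hj
      exact (softmax_le_exp_sub s j k).trans (Real.exp_le_exp.mpr (by linarith))
    calc ∑ j ∈ Jᶜ, softmax s j
        ≤ (Jᶜ.card : ℝ) * Real.exp (-(J.inf' ⟨k, hk⟩ s - Jᶜ.sup' h s)) := by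
          simpa only [nsmul_eq_mul] using Finset.sum_le_card_nsmul _ _ _ bound
      _ ≤ (n : ℝ) * Real.exp (-(J.inf' ⟨k, hk⟩ s - Jᶜ.sup' h s)) := by
          gcongr
          simpa using Finset.card_le_univ Jᶜ
  · rw [Finset.not_nonempty_iff_eq_empty.mp h, Finset.sum_empty]
end

section
/- Let b_m ∈ ℕ, b_e ∈ ℕ with b_e ≥ 2, and n ∈ ℕ with 1/n ≥ 2^{E_min}, and set F = F_{b_m,b_e}. Let s = (s_0,…,s_{n−1}) ∈ ℝ^n with separation β = sep(s), and let α = softmax(s). Then for any choice of roundings it holds that Σ_{j=0}^{n−1} |α_j − [α_j]_F| ≤ 2^{−b_m−1} + n·e^{−β}. -/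
open Classical

/-- Smallest exponent of the floating-point format with `be` exponent bits. -/
def Emin (be : ℕ) : ℤ := 2 - 2 ^ (be - 1)

/-- Largest exponent of the floating-point format with `be` exponent bits. -/
def Emax (be : ℕ) : ℤ := 2 ^ (be - 1) - 1

/-- The set of floating-point numbers with `bm` mantissa bits and `be` exponent bits. -/
def floatSet (bm be : ℕ) : Set ℝ :=
  {x | ∃ (ε : ℝ) (t : ℕ) (κ : ℤ), (ε = 1 ∨ ε = -1) ∧ t < 2 ^ bm ∧
      Emin be ≤ κ ∧ κ ≤ Emax be ∧
      x = ε * (1 + (t : ℝ) * (2 : ℝ) ^ (-(bm : ℤ))) * (2 : ℝ) ^ κ} ∪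
  {x | ∃ (ε : ℝ) (t : ℕ), (ε = 1 ∨ ε = -1) ∧ t < 2 ^ bm ∧
      x = ε * ((t : ℝ) * (2 : ℝ) ^ (-(bm : ℤ))) * (2 : ℝ) ^ (Emin be)}

/-- `y` is a rounding of `x` to the set `F` if `y ∈ F` minimizes the distance to `x`. -/
def IsRounding (F : Set ℝ) (x y : ℝ) : Prop :=
  y ∈ F ∧ ∀ z ∈ F, |x - y| ≤ |x - z|

/-- The set of indices attaining the maximal score. -/
def argmaxSet {n : ℕ} (s : Fin n → ℝ) : Set (Fin n) := {j | ∀ l, s l ≤ s j}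

/-- The separation of the scores (meaningful when the complement of the argmax set is
nonempty; when empty the separation is `+∞`). -/
noncomputable def sepScore {n : ℕ} (s : Fin n → ℝ) : ℝ :=
  sInf (s '' argmaxSet s) - sSup (s '' (argmaxSet s)ᶜ)

theorem zero_mem_floatSet (bm be : ℕ) : (0 : ℝ) ∈ floatSet bm be :=
  Or.inr ⟨1, 0, Or.inl rfl, by positivity, by simp⟩

theorem exists_mem_floatSet_abs_sub_le {bm be : ℕ} (hbe : 2 ≤ be) {a : ℝ}
    (ha : (2 : ℝ) ^ Emin be ≤ a) (ha1 : a ≤ 1) :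
    ∃ z ∈ floatSet bm be, |a - z| ≤ (2 : ℝ) ^ (-(bm : ℤ) - 1) * a := by
  have ha0 : 0 < a := lt_of_lt_of_le (by positivity) ha
  obtain ⟨κ, hκ, hκ'⟩ := exists_mem_Ico_zpow ha0 (one_lt_two : (1 : ℝ) < 2)
  have hκ0 : κ ≤ 0 := by
    rw [← zpow_le_zpow_iff_right₀ (one_lt_two : (1 : ℝ) < 2), zpow_zero]
    exact hκ.trans ha1
  have hEκ : Emin be ≤ κ := by
    rw [← Int.lt_add_one_iff, ← zpow_lt_zpow_iff_right₀ (one_lt_two : (1 : ℝ) < 2)]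
    exact ha.trans_lt hκ'
  have hEmax : 1 ≤ Emax be := by
    have h : (2 : ℤ) ^ 1 ≤ 2 ^ (be - 1) := pow_le_pow_right₀ (by norm_num) (by omega)
    unfold Emax
    omega
  set p : ℝ := (2 : ℝ) ^ κ with hp
  have hp0 : 0 < p := by positivity
  have hq0 : (0 : ℝ) < 2 ^ bm := by positivity
  have hp1 : (2 : ℝ) ^ (κ + 1) = 2 * p := by
    rw [zpow_add_one₀ (by norm_num), mul_comm]
  have hq : (2 : ℝ) ^ (-(bm : ℤ)) = (2 ^ bm)⁻¹ := by rw [zpow_neg, zpow_natCast]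
  have hq1 : (2 : ℝ) ^ (-(bm : ℤ) - 1) = (2 ^ bm)⁻¹ / 2 := by
    rw [zpow_sub_one₀ (by norm_num), hq, div_eq_mul_inv]
  set y : ℝ := (a / p - 1) * 2 ^ bm with hy
  have hy0 : 0 ≤ y := mul_nonneg (sub_nonneg.2 ((one_le_div hp0).2 hκ)) hq0.le
  have hyq : y < 2 ^ bm := by
    have h : a / p < 2 := (div_lt_iff₀ hp0).2 (hp1 ▸ hκ')
    nlinarith
  set t : ℕ := ⌊y + 1 / 2⌋₊ with ht
  have ht1 : (t : ℝ) ≤ y + 1 / 2 := Nat.floor_le (by positivity)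
  have ht2 : y + 1 / 2 < t + 1 := Nat.lt_floor_add_one _
  have htq : t ≤ 2 ^ bm := by
    have h : (t : ℝ) < ((2 ^ bm + 1 : ℕ) : ℝ) := by push_cast; linarith
    exact Nat.lt_succ_iff.1 (Nat.cast_lt.1 h)
  refine ⟨(1 + t * (2 ^ bm)⁻¹) * p, ?_, ?_⟩
  · rcases htq.lt_or_eq with hlt | heq
    · exact Or.inl ⟨1, t, κ, Or.inl rfl, hlt, hEκ, by omega, by rw [hq, one_mul]⟩
    · refine Or.inl ⟨1, 0, κ + 1, Or.inl rfl, by positivity, by omega, by omega, ?_⟩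
      rw [hp1, heq]
      push_cast
      rw [mul_inv_cancel₀ hq0.ne']
      ring
  · have hsub : a - (1 + t * (2 ^ bm)⁻¹) * p = (y - t) * ((2 ^ bm)⁻¹ * p) := by
      rw [hy]
      field_simp
      ring
    have hyt : |y - t| ≤ 1 / 2 := abs_le.2 ⟨by linarith, by linarith⟩
    rw [hsub, hq1, abs_mul, abs_of_pos (by positivity : 0 < (2 ^ bm : ℝ)⁻¹ * p)]
    calc |y - t| * ((2 ^ bm)⁻¹ * p) ≤ 1 / 2 * ((2 ^ bm)⁻¹ * a) := by gcongr
      _ = (2 ^ bm)⁻¹ / 2 * a := by ring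

theorem softmax_nonneg {n : ℕ} (s : Fin n → ℝ) (j : Fin n) : 0 ≤ softmax s j := by
  unfold softmax
  positivity

theorem sum_exp_pos {n : ℕ} (s : Fin n → ℝ) (j : Fin n) : 0 < ∑ l, Real.exp (s l) :=
  Finset.sum_pos (fun _ _ => Real.exp_pos _) ⟨j, Finset.mem_univ j⟩

theorem sum_softmax_le_one {n : ℕ} (s : Fin n → ℝ) : ∑ j, softmax s j ≤ 1 := by
  simp only [softmax, ← Finset.sum_div]
  exact div_self_le_one _

theorem softmax_le_one {n : ℕ} (s : Fin n → ℝ) (j : Fin n) : softmax s j ≤ 1 :=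
  (Finset.single_le_sum (fun i _ => softmax_nonneg s i) (Finset.mem_univ j)).trans
    (sum_softmax_le_one s)

theorem one_div_le_softmax_of_mem_argmaxSet {n : ℕ} {s : Fin n → ℝ} {j : Fin n}
    (hj : j ∈ argmaxSet s) : 1 / (n : ℝ) ≤ softmax s j := by
  have hn : (0 : ℝ) < n := Nat.cast_pos.2 j.pos
  have hsum : ∑ l, Real.exp (s l) ≤ n * Real.exp (s j) := by
    simpa using Finset.sum_le_card_nsmul Finset.univ (fun l => Real.exp (s l))
      (Real.exp (s j)) (fun l _ => Real.exp_le_exp.2 (hj l))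
  unfold softmax
  rw [div_le_div_iff₀ hn (sum_exp_pos s j)]
  linarith

theorem argmaxSet_nonempty {n : ℕ} (s : Fin n → ℝ) (j : Fin n) : (argmaxSet s).Nonempty := by
  have : Nonempty (Fin n) := ⟨j⟩
  obtain ⟨i, hi⟩ := Finite.exists_max s
  exact ⟨i, hi⟩

theorem softmax_le_exp_neg_sepScore {n : ℕ} {s : Fin n → ℝ} {j : Fin n}
    (hj : j ∉ argmaxSet s) : softmax s j ≤ Real.exp (-(sepScore s)) := by
  obtain ⟨i, hi⟩ := argmaxSet_nonempty s j
  have hinf : sInf (s '' argmaxSet s) ≤ s i :=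
    csInf_le (Set.toFinite _).bddBelow ⟨i, hi, rfl⟩
  have hsup : s j ≤ sSup (s '' (argmaxSet s)ᶜ) :=
    le_csSup (Set.toFinite _).bddAbove ⟨j, hj, rfl⟩
  have hsum : Real.exp (s i) ≤ ∑ l, Real.exp (s l) :=
    Finset.single_le_sum (f := fun l => Real.exp (s l)) (fun _ _ => (Real.exp_pos _).le)
      (Finset.mem_univ i)
  calc softmax s j ≤ Real.exp (s j) / Real.exp (s i) := by
        unfold softmax
        gcongr
    _ = Real.exp (s j - s i) := (Real.exp_sub _ _).symm
    _ ≤ Real.exp (-(sepScore s)) := by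
        rw [Real.exp_le_exp, sepScore]
        linarith

/-- Summed attention-weight rounding error: if `1/n ≥ 2^{Emin}` and `β = sep(s)`,
then for any choice of roundings `r j` of the softmax weights to `floatSet bm be`,
`Σ_j |α_j − [α_j]_F| ≤ 2^{−bm−1} + n·e^{−β}` (the last term being `0` when `β = +∞`,
i.e. when the complement of the argmax set is empty). -/
theorem softmax_rounding_error (bm be n : ℕ) (hbe : 2 ≤ be)
    (hn : (2 : ℝ) ^ (Emin be) ≤ 1 / (n : ℝ))
    (s : Fin n → ℝ) (r : Fin n → ℝ)
    (hr : ∀ j, IsRounding (floatSet bm be) (softmax s j) (r j)) :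
    ∑ j, |softmax s j - r j| ≤
      (2 : ℝ) ^ (-(bm : ℤ) - 1) +
      (if ((argmaxSet s)ᶜ : Set (Fin n)).Nonempty
       then (n : ℝ) * Real.exp (-(sepScore s))
       else 0) := by
  have hpt : ∀ j, |softmax s j - r j| ≤ (2 : ℝ) ^ (-(bm : ℤ) - 1) * softmax s j +
      (if ((argmaxSet s)ᶜ : Set (Fin n)).Nonempty then Real.exp (-(sepScore s)) else 0) := by
    intro j
    by_cases hj : j ∈ argmaxSet s
    · obtain ⟨z, hz, hle⟩ := exists_mem_floatSet_abs_sub_le (bm := bm) hbe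
        (hn.trans (one_div_le_softmax_of_mem_argmaxSet hj)) (softmax_le_one s j)
      refine ((hr j).2 z hz).trans (hle.trans (le_add_of_nonneg_right ?_))
      split_ifs <;> positivity
    · have hle : |softmax s j - r j| ≤ softmax s j := by
        simpa [abs_of_nonneg (softmax_nonneg s j)] using (hr j).2 0 (zero_mem_floatSet bm be)
      rw [if_pos ⟨j, hj⟩]
      exact (hle.trans (softmax_le_exp_neg_sepScore hj)).trans
        (le_add_of_nonneg_left (mul_nonneg (by positivity) (softmax_nonneg s j)))
  refine (Finset.sum_le_sum fun j _ => hpt j).trans ?_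
  rw [Finset.sum_add_distrib, ← Finset.mul_sum]
  refine add_le_add (mul_le_of_le_one_right (by positivity) (sum_softmax_le_one s)) ?_
  split_ifs <;> simp
end

section
/- Let d ∈ ℕ, let I₁,…,I_n be registers and F₁,…,F_m be flags in dimension d, all pairwise disjoint. Let x*_i ∈ {−1,1}^{|I_i|} for i = 1,…,n, let b*_j ∈ {0,1} for j = 1,…,m, and let y ∈ {−1,0,1}^d. Then there exists an MLP f with input dimension d, hidden dimension 1 and ternary weights such that for every x ∈ {−1,0,1}^d with x[F_j] ∈ {0,1} for all j: f(x) = y if x[I_i] = x*_i for all i and x[F_j] = b*_j for all j, and f(x) = 0 otherwise. Moreover, on these inputs the hidden activation of f lies in {0,1} and the output lies in {−1,0,1}^d. -/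
/-- A single-hidden-layer ReLU MLP `x ↦ W₂ ReLU(W₁ x + b)` with input/output dimension `d`
and hidden dimension `dff`. -/
structure MLP (d dff : ℕ) where
  W1 : Matrix (Fin dff) (Fin d) ℝ
  b : Fin dff → ℝ
  W2 : Matrix (Fin d) (Fin dff) ℝ

/-- The hidden activations `ReLU(W₁ x + b)` of the MLP. -/
noncomputable def MLP.hidden {d dff : ℕ} (f : MLP d dff) (x : Fin d → ℝ) : Fin dff → ℝ :=
  fun h => max 0 (f.W1.mulVec x h + f.b h)

/-- The output `W₂ ReLU(W₁ x + b)` of the MLP. -/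
noncomputable def MLP.eval {d dff : ℕ} (f : MLP d dff) (x : Fin d → ℝ) : Fin d → ℝ :=
  f.W2.mulVec (f.hidden x)

/-- The MLP has ternary weights: all entries of `W₁` and `W₂` lie in `{-1,0,1}`. -/
def MLP.Ternary {d dff : ℕ} (f : MLP d dff) : Prop :=
  (∀ i j, f.W1 i j = -1 ∨ f.W1 i j = 0 ∨ f.W1 i j = 1) ∧
  (∀ i j, f.W2 i j = -1 ∨ f.W2 i j = 0 ∨ f.W2 i j = 1)

def IsTernary (a : ℝ) : Prop := a = -1 ∨ a = 0 ∨ a = 1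
def IsBit (a : ℝ) : Prop := a = 0 ∨ a = 1
def IsSign (a : ℝ) : Prop := a = -1 ∨ a = 1

theorem max_zero_one_sub_sum_of_all {κ : Type*} [Fintype κ] (δ : κ → ℝ) (h : ∀ k, δ k = 0) :
    max 0 (1 - ∑ k, δ k) = 1 := by
  simp [h]

theorem max_zero_one_sub_sum_of_exists {κ : Type*} [Fintype κ] (δ : κ → ℝ)
    (h0 : ∀ k, 0 ≤ δ k) (h1 : ∃ k, 1 ≤ δ k) :
    max 0 (1 - ∑ k, δ k) = 0 := by
  obtain ⟨k, hk⟩ := h1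
  have := Finset.single_le_sum (fun k _ => h0 k) (Finset.mem_univ k)
  exact max_eq_left (by linarith)

theorem sum_extend_mul {κ ι : Type*} [Fintype κ] [Fintype ι] {e : κ → ι}
    (he : Function.Injective e) (c : κ → ℝ) (x : ι → ℝ) :
    ∑ j, Function.extend e c 0 j * x j = ∑ k, c k * x (e k) := by
  refine (Fintype.sum_of_injective e he _ _ (fun j hj => ?_) (fun k => ?_)).symm
  · rw [Function.extend_apply' _ _ _ (by simpa using hj)]
    simp
  · rw [he.extend_apply]

theorem isTernary_extend {κ ι : Type*} {e : κ → ι} (he : Function.Injective e) {c : κ → ℝ}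
    (hc : ∀ k, IsTernary (c k)) (j : ι) : IsTernary (Function.extend e c 0 j) := by
  by_cases hj : ∃ k, e k = j
  · obtain ⟨k, rfl⟩ := hj
    rw [he.extend_apply]
    exact hc k
  · rw [Function.extend_apply' _ _ _ hj]
    exact Or.inr (Or.inl rfl)

/-- A single ReLU neuron can detect the pattern `t` on the coordinates `e`, provided each
coordinate has a ternary weight `c k` for which any mismatch costs at least `1`. -/
theorem exists_pattern_detector {d : ℕ} {κ : Type*} [Fintype κ] {e : κ → Fin d}
    (he : Function.Injective e) {c t : κ → ℝ} (hc : ∀ k, IsTernary (c k))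
    {y : Fin d → ℝ} (hy : ∀ i, IsTernary (y i)) :
    ∃ f : MLP d 1, f.Ternary ∧
      ∀ x : Fin d → ℝ, (∀ k, x (e k) ≠ t k → 1 ≤ c k * (t k - x (e k))) →
        ((∀ k, x (e k) = t k) → f.eval x = y ∧ ∀ h, f.hidden x h = 1) ∧
        ((¬ ∀ k, x (e k) = t k) → f.eval x = 0 ∧ ∀ h, f.hidden x h = 0) := by
  let f : MLP d 1 :=
    ⟨fun _ => Function.extend e c 0, fun _ => 1 - ∑ k, c k * t k, fun i _ => y i⟩
  have eval_eq (x : Fin d → ℝ) (a : ℝ) (ha : ∀ h, f.hidden x h = a) :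
      f.eval x = fun i => y i * a := by
    funext i
    simp [MLP.eval, Matrix.mulVec, dotProduct, ha, f]
  have hidden_eq (x : Fin d → ℝ) (h : Fin 1) :
      f.hidden x h = max 0 (1 - ∑ k, c k * (t k - x (e k))) := by
    simp only [MLP.hidden, Matrix.mulVec, dotProduct, f, sum_extend_mul he, mul_sub,
      Finset.sum_sub_distrib]
    congr 1
    ring
  refine ⟨f, ⟨fun _ => isTernary_extend he hc, fun i _ => hy i⟩,
    fun x hx => ⟨fun hm => ?_, fun hm => ?_⟩⟩
  · have hh : ∀ h, f.hidden x h = 1 := fun h =>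
      (hidden_eq x h).trans (max_zero_one_sub_sum_of_all _ fun k => by simp [hm k])
    exact ⟨by simp [eval_eq x 1 hh], hh⟩
  · have hh : ∀ h, f.hidden x h = 0 := fun h => by
      refine (hidden_eq x h).trans (max_zero_one_sub_sum_of_exists _ (fun k => ?_) ?_)
      · by_cases hk : x (e k) = t k
        · simp [hk]
        · exact zero_le_one.trans (hx k hk)
      · obtain ⟨k, hk⟩ := not_forall.mp hm
        exact ⟨k, hx k hk⟩
    exact ⟨by rw [eval_eq x 0 hh]; ext; simp, hh⟩

theorem one_le_mul_sub_of_isSign {s a : ℝ} (hs : IsSign s) (ha : IsTernary a) (h : a ≠ s) :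
    1 ≤ s * (s - a) := by
  rcases hs with rfl | rfl <;> rcases ha with rfl | rfl | rfl <;>
    first | exact absurd rfl h | norm_num

theorem one_le_mul_sub_of_isBit {b a : ℝ} (hb : IsBit b) (ha : IsBit a) (h : a ≠ b) :
    1 ≤ (2 * b - 1) * (b - a) := by
  rcases hb with rfl | rfl <;> rcases ha with rfl | rfl <;>
    first | exact absurd rfl h | norm_num

/-- Single-neuron MLP (Lemma: Single Neuron MLP). Given pairwise disjoint registers
`I i` and flags `Fl j`, target register patterns `xstar i ∈ {-1,1}^{len i}`, target flag
bits `bstar j ∈ {0,1}` and an output vector `y ∈ {-1,0,1}^d`, there is a one-hidden-neuron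
ternary MLP which outputs `y` on admissible inputs matching the pattern and `0` on all
other admissible inputs; its hidden activation is in `{0,1}` and its output is ternary. -/
theorem single_neuron_mlp (d N m : ℕ) (len : Fin N → ℕ)
    (I : ∀ i : Fin N, Fin (len i) → Fin d) (Fl : Fin m → Fin d)
    (hdisj : Function.Injective
      (Sum.elim (fun q : Σ i : Fin N, Fin (len i) => I q.1 q.2) Fl))
    (xstar : ∀ i : Fin N, Fin (len i) → ℝ) (hxstar : ∀ i t, IsSign (xstar i t))
    (bstar : Fin m → ℝ) (hbstar : ∀ j, IsBit (bstar j))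
    (y : Fin d → ℝ) (hy : ∀ i, IsTernary (y i)) :
    ∃ f : MLP d 1, f.Ternary ∧
      ∀ x : Fin d → ℝ, (∀ i, IsTernary (x i)) → (∀ j, IsBit (x (Fl j))) →
        (((∀ i t, x (I i t) = xstar i t) ∧ (∀ j, x (Fl j) = bstar j)) → f.eval x = y) ∧
        (¬ ((∀ i t, x (I i t) = xstar i t) ∧ (∀ j, x (Fl j) = bstar j)) →
          f.eval x = 0) ∧
        (∀ h, f.hidden x h = 0 ∨ f.hidden x h = 1) ∧
        (∀ i, IsTernary (f.eval x i)) := by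
  have hc : ∀ k, IsTernary (Sum.elim (fun q : Σ i : Fin N, Fin (len i) => xstar q.1 q.2)
      (fun j => 2 * bstar j - 1) k) := by
    rintro (⟨i, t⟩ | j)
    · exact (hxstar i t).imp_right Or.inr
    · rcases hbstar j with h | h <;> norm_num [IsTernary, h]
  obtain ⟨f, hf, H⟩ := exists_pattern_detector hdisj
    (t := Sum.elim (fun q : Σ i : Fin N, Fin (len i) => xstar q.1 q.2) bstar) hc hy
  refine ⟨f, hf, fun x hx hxF => ?_⟩
  obtain ⟨hmatch, hmiss⟩ := H x (by
    rintro (⟨i, t⟩ | j) hne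
    · exact one_le_mul_sub_of_isSign (hxstar i t) (hx _) hne
    · exact one_le_mul_sub_of_isBit (hbstar j) (hxF j) hne)
  simp only [Sum.forall, Sigma.forall, Sum.elim_inl, Sum.elim_inr] at hmatch hmiss
  refine ⟨fun hm => (hmatch hm).1, fun hm => (hmiss hm).1, fun h => ?_, fun i => ?_⟩
  · by_cases hm : (∀ i t, x (I i t) = xstar i t) ∧ (∀ j, x (Fl j) = bstar j)
    · exact Or.inr ((hmatch hm).2 h)
    · exact Or.inl ((hmiss hm).2 h)
  · by_cases hm : (∀ i t, x (I i t) = xstar i t) ∧ (∀ j, x (Fl j) = bstar j)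
    · rw [(hmatch hm).1]
      exact hy i
    · rw [(hmiss hm).1]
      exact Or.inr (Or.inl rfl)
end

section
/- Let d ∈ ℕ, let I be a register, F₁,…,F_m flags, all pairwise disjoint, and b*_1,…,b*_m ∈ {0,1}. Then there exists an MLP f with input dimension d, hidden dimension 2|I| and ternary weights such that for all x ∈ {−1,0,1}^d with x[F_j] ∈ {0,1} for all j: f(x)[I] = −x[I] if x[F_j] = b*_j for all j, and f(x)[I] = 0 otherwise; and all coordinates of f(x) at indices not in I are 0. -/
/-- Pairing a vector extended by zero along an injection `g` with `x` only sees `x ∘ g`. -/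
theorem sum_extend_zero_mul {ι κ : Type*} [Fintype ι] [Fintype κ] {g : κ → ι}
    (hg : Function.Injective g) (c : κ → ℝ) (x : ι → ℝ) :
    ∑ i, Function.extend g c 0 i * x i = ∑ k, c k * x (g k) := by
  refine (Fintype.sum_of_injective g hg _ _ (fun i hi => ?_) (fun k => ?_)).symm
  · rw [Function.extend_apply' _ _ _ (by simpa using hi)]
    simp
  · rw [hg.extend_apply]

theorem IsTernary.extend_zero {ι κ : Type*} {g : κ → ι} (hg : Function.Injective g) {c : κ → ℝ}
    (hc : ∀ k, IsTernary (c k)) (i : ι) : IsTernary (Function.extend g c 0 i) := by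
  by_cases hi : ∃ k, g k = i
  · obtain ⟨k, rfl⟩ := hi
    rw [hg.extend_apply]
    exact hc k
  · rw [Function.extend_apply' _ _ _ hi]
    exact Or.inr (Or.inl rfl)

/-- For bits `a` and `b`, the affine expression `b - (2b - 1)a` is the indicator of `a ≠ b`. -/
theorem IsBit.mismatch_eq {a b : ℝ} (ha : IsBit a) (hb : IsBit b) :
    b - (2 * b - 1) * a = if a = b then 0 else 1 := by
  rcases ha with rfl | rfl <;> rcases hb with rfl | rfl <;> norm_num

/-- The two signs carried by the pair of hidden neurons attached to a register entry. -/
def neuronSign : Fin 2 → ℝ := ![1, -1]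

/-- The MLP with hidden neurons `ReLU(± x[I t] - #{j | x[F_j] ≠ b*_j})`, which the output layer
combines with signs `∓` into the coordinate `I t`. -/
noncomputable def zeroingMLP {d dI m : ℕ} (I : Fin dI → Fin d) (Fl : Fin m → Fin d)
    (bstar : Fin m → ℝ) : MLP d (2 * dI) where
  W1 := fun h => Function.extend (Sum.elim I Fl)
    (Sum.elim (Pi.single (finProdFinEquiv.symm h).2 (neuronSign (finProdFinEquiv.symm h).1))
      (fun j => 2 * bstar j - 1)) 0
  b := fun _ => -∑ j, bstar j
  W2 := fun i h => Function.extend I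
    (Pi.single (finProdFinEquiv.symm h).2 (-neuronSign (finProdFinEquiv.symm h).1)) 0 i

theorem isTernary_single {n : ℕ} (t t' : Fin n) {a : ℝ} (ha : IsTernary a) :
    IsTernary ((Pi.single t a : Fin n → ℝ) t') := by
  rw [Pi.single_apply]
  split_ifs
  · exact ha
  · exact Or.inr (Or.inl rfl)

section

variable {d dI m : ℕ} {I : Fin dI → Fin d} {Fl : Fin m → Fin d} {bstar : Fin m → ℝ}

theorem zeroingMLP_ternary (hdisj : Function.Injective (Sum.elim I Fl))
    (hbstar : ∀ j, IsBit (bstar j)) : (zeroingMLP I Fl bstar).Ternary := by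
  have hI : Function.Injective I := hdisj.comp Sum.inl_injective
  have hs : ∀ s, IsTernary (neuronSign s) ∧ IsTernary (-neuronSign s) := by
    intro s
    fin_cases s <;> simp [neuronSign, IsTernary]
  refine ⟨fun h => IsTernary.extend_zero hdisj ?_,
    fun i h => IsTernary.extend_zero hI (c := Pi.single (finProdFinEquiv.symm h).2 _)
      (fun t => isTernary_single _ t (hs (finProdFinEquiv.symm h).1).2) i⟩
  rintro (t | j)
  · exact isTernary_single _ _ (hs _).1
  · rcases hbstar j with hj | hj <;> simp [hj, IsTernary] <;> norm_num

theorem zeroingMLP_hidden (hdisj : Function.Injective (Sum.elim I Fl)) (x : Fin d → ℝ)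
    (s : Fin 2) (t : Fin dI) :
    (zeroingMLP I Fl bstar).hidden x (finProdFinEquiv (s, t)) =
      max 0 (neuronSign s * x (I t) - ∑ j, (bstar j - (2 * bstar j - 1) * x (Fl j))) := by
  have h : (zeroingMLP I Fl bstar).W1.mulVec x (finProdFinEquiv (s, t)) =
      neuronSign s * x (I t) + ∑ j, (2 * bstar j - 1) * x (Fl j) := by
    simp only [Matrix.mulVec, dotProduct, zeroingMLP, Equiv.symm_apply_apply]
    rw [sum_extend_zero_mul hdisj, Fintype.sum_sum_type]
    simp [Pi.single_apply]
  rw [MLP.hidden, h, Finset.sum_sub_distrib]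
  congr 1
  simp only [zeroingMLP]
  ring

theorem zeroingMLP_eval (hdisj : Function.Injective (Sum.elim I Fl)) (x : Fin d → ℝ)
    (t : Fin dI) :
    (zeroingMLP I Fl bstar).eval x (I t) =
      max 0 (-x (I t) - ∑ j, (bstar j - (2 * bstar j - 1) * x (Fl j))) -
        max 0 (x (I t) - ∑ j, (bstar j - (2 * bstar j - 1) * x (Fl j))) := by
  have hI : Function.Injective I := hdisj.comp Sum.inl_injective
  simp only [MLP.eval, Matrix.mulVec, dotProduct]
  rw [← finProdFinEquiv.sum_comp, Fintype.sum_prod_type, Fin.sum_univ_two]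
  simp only [zeroingMLP_hidden hdisj]
  simp only [zeroingMLP, Equiv.symm_apply_apply, hI.extend_apply, Pi.single_apply]
  simp [neuronSign]
  ring

theorem zeroingMLP_eval_of_notMem_range (x : Fin d → ℝ) {i : Fin d} (hi : i ∉ Set.range I) :
    (zeroingMLP I Fl bstar).eval x i = 0 := by
  simp only [MLP.eval, Matrix.mulVec, dotProduct, zeroingMLP]
  refine Finset.sum_eq_zero fun h _ => ?_
  rw [Function.extend_apply' _ _ _ (by simpa using hi)]
  simp

end

/-- Zeroing lemma: there is a ternary MLP with hidden dimension `2|I|` which, on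
admissible ternary inputs with binary flag values, outputs `-x[I]` on the register `I`
if all flags match the target bits `bstar`, outputs `0` on `I` otherwise, and always
outputs `0` on coordinates outside `I`. -/
theorem zeroing_mlp (d dI m : ℕ) (I : Fin dI → Fin d) (Fl : Fin m → Fin d)
    (hdisj : Function.Injective (Sum.elim I Fl))
    (bstar : Fin m → ℝ) (hbstar : ∀ j, IsBit (bstar j)) :
    ∃ f : MLP d (2 * dI), f.Ternary ∧
      ∀ x : Fin d → ℝ, (∀ i, IsTernary (x i)) → (∀ j, IsBit (x (Fl j))) →
        ((∀ j, x (Fl j) = bstar j) → ∀ t, f.eval x (I t) = - x (I t)) ∧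
        (¬ (∀ j, x (Fl j) = bstar j) → ∀ t, f.eval x (I t) = 0) ∧
        (∀ i, i ∉ Set.range I → f.eval x i = 0) := by
  refine ⟨zeroingMLP I Fl bstar, zeroingMLP_ternary hdisj hbstar, fun x hx hF =>
    ⟨fun hall t => ?_, fun hne t => ?_, fun i hi => zeroingMLP_eval_of_notMem_range x hi⟩⟩
  all_goals
    rw [zeroingMLP_eval hdisj]
    simp only [fun j => (hF j).mismatch_eq (hbstar j)]
  · simp only [hall, if_true, Finset.sum_const_zero, sub_zero]
    rcases le_total 0 (x (I t)) with h | h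
    · rw [max_eq_left (by linarith), max_eq_right h, zero_sub]
    · rw [max_eq_right (by linarith), max_eq_left h, sub_zero]
  · obtain ⟨j, hj⟩ := not_forall.mp hne
    have hM : (1 : ℝ) ≤ ∑ j, if x (Fl j) = bstar j then 0 else 1 := by
      have := Finset.single_le_sum (f := fun j => if x (Fl j) = bstar j then (0 : ℝ) else 1)
        (fun k _ => by split_ifs <;> norm_num) (Finset.mem_univ j)
      simpa only [if_neg hj] using this
    have hle : -1 ≤ x (I t) ∧ x (I t) ≤ 1 := by
      rcases hx (I t) with h | h | h <;> rw [h] <;> norm_num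
    rw [max_eq_left (by linarith), max_eq_left (by linarith), sub_zero]
end

section
/- Let d ∈ ℕ, let I₁, I₂ be registers with |I₁| = |I₂| = d', let F₁,…,F_m be flags, all pairwise disjoint, and let b*_1,…,b*_m ∈ {0,1}. Then there exists an MLP f with input dimension d, hidden dimension 2d' and ternary weights such that for all x ∈ {−1,0,1}^d with x[F_j] ∈ {0,1} for all j: f(x)[I₂] = x[I₁] if x[F_j] = b*_j for all j, and f(x)[I₂] = 0 otherwise; and all coordinates of f(x) at indices not in I₂ are 0. -/
/-- The gated copying MLP. The hidden unit `(s, t)` computes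
`max 0 (± x[I1 t] - k)` with `k` the number of flags differing from `bstar`, where the sign
is `+` for `s = 0` and `-` for `s = 1`. -/
noncomputable def copyMLP {d d' m : ℕ} (I1 I2 : Fin d' → Fin d) (Fl : Fin m → Fin d)
    (bstar : Fin m → ℝ) : MLP d (2 * d') where
  W1 := fun h i =>
    (if i = I1 (finProdFinEquiv.symm h).2 then ![1, -1] (finProdFinEquiv.symm h).1 else 0) +
      ∑ j, if i = Fl j then 2 * bstar j - 1 else 0
  b := fun _ => -∑ j, bstar j
  W2 := fun i h =>
    if i = I2 (finProdFinEquiv.symm h).2 then ![1, -1] (finProdFinEquiv.symm h).1 else 0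

section CopyMLP

variable {d d' m : ℕ} {I1 I2 : Fin d' → Fin d} {Fl : Fin m → Fin d} {bstar : Fin m → ℝ}

theorem isTernary_sign (s : Fin 2) : IsTernary ((![1, -1] : Fin 2 → ℝ) s) := by
  fin_cases s <;> simp [IsTernary]

theorem copyMLP_ternary (hFl : Function.Injective Fl) (hI1 : ∀ t j, I1 t ≠ Fl j)
    (hbstar : ∀ j, IsBit (bstar j)) : (copyMLP I1 I2 Fl bstar).Ternary := by
  constructor
  · intro h i
    change IsTernary ((if i = I1 _ then _ else 0) + ∑ j, if i = Fl j then 2 * bstar j - 1 else 0)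
    by_cases hi : ∃ j, i = Fl j
    · obtain ⟨j, rfl⟩ := hi
      rw [if_neg (hI1 _ j).symm, zero_add]
      simp only [hFl.eq_iff, Finset.sum_ite_eq, Finset.mem_univ, if_true]
      rcases hbstar j with hb | hb <;> rw [hb] <;> norm_num [IsTernary]
    · push Not at hi
      simp only [hi, if_false, Finset.sum_const_zero, add_zero]
      split_ifs
      · exact isTernary_sign _
      · exact Or.inr (Or.inl rfl)
  · intro i h
    change IsTernary (if i = I2 _ then _ else 0)
    split_ifs
    · exact isTernary_sign _
    · exact Or.inr (Or.inl rfl)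

theorem copyMLP_hidden (x : Fin d → ℝ) (s : Fin 2) (t : Fin d') :
    (copyMLP I1 I2 Fl bstar).hidden x (finProdFinEquiv (s, t)) =
      max 0 (![1, -1] s * x (I1 t) + ∑ j, ((2 * bstar j - 1) * x (Fl j) - bstar j)) := by
  simp only [MLP.hidden, copyMLP, Matrix.mulVec, dotProduct, Equiv.symm_apply_apply, add_mul,
    Finset.sum_mul, Finset.sum_add_distrib, ite_mul, zero_mul, Finset.sum_ite_eq',
    Finset.mem_univ, if_true, Finset.sum_sub_distrib]
  rw [Finset.sum_comm]
  simp only [Finset.sum_ite_eq', Finset.mem_univ, if_true]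
  ring_nf

theorem copyMLP_eval (x : Fin d → ℝ) (i : Fin d) :
    (copyMLP I1 I2 Fl bstar).eval x i = ∑ t, if i = I2 t then
      max 0 (x (I1 t) + ∑ j, ((2 * bstar j - 1) * x (Fl j) - bstar j)) -
        max 0 (-x (I1 t) + ∑ j, ((2 * bstar j - 1) * x (Fl j) - bstar j)) else 0 := by
  rw [MLP.eval, Matrix.mulVec, dotProduct, ← finProdFinEquiv.sum_comp, Fintype.sum_prod_type_right]
  refine Finset.sum_congr rfl fun t _ => ?_
  simp only [copyMLP_hidden, Fin.sum_univ_two]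
  simp only [copyMLP, Equiv.symm_apply_apply]
  split_ifs <;> simp [sub_eq_add_neg]

theorem flag_term_nonpos {a b : ℝ} (ha : IsBit a) (hb : IsBit b) : (2 * b - 1) * a - b ≤ 0 := by
  rcases ha with rfl | rfl <;> rcases hb with rfl | rfl <;> norm_num

theorem flag_term_eq_zero {b : ℝ} (hb : IsBit b) : (2 * b - 1) * b - b = 0 := by
  rcases hb with rfl | rfl <;> norm_num

theorem flag_term_of_ne {a b : ℝ} (ha : IsBit a) (hb : IsBit b) (h : a ≠ b) :
    (2 * b - 1) * a - b = -1 := by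
  rcases ha with rfl | rfl <;> rcases hb with rfl | rfl <;> first | exact absurd rfl h | norm_num

theorem sum_flag_term_le {a b : Fin m → ℝ} (ha : ∀ j, IsBit (a j)) (hb : ∀ j, IsBit (b j))
    (h : ¬ ∀ j, a j = b j) : ∑ j, ((2 * b j - 1) * a j - b j) ≤ -1 := by
  push Not at h
  obtain ⟨j, hj⟩ := h
  rw [← Finset.add_sum_erase _ _ (Finset.mem_univ j), flag_term_of_ne (ha j) (hb j) hj]
  linarith [Finset.sum_nonpos (s := Finset.univ.erase j)
    fun k _ => flag_term_nonpos (ha k) (hb k)]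

end CopyMLP

/-- Copying lemma: there is a ternary MLP with hidden dimension `2d'` which, on
admissible ternary inputs with binary flag values, outputs `x[I₁]` on the register `I₂`
if all flags match the target bits `bstar`, outputs `0` on `I₂` otherwise, and always
outputs `0` on coordinates outside `I₂`. -/
theorem copying_mlp (d d' m : ℕ) (I1 I2 : Fin d' → Fin d) (Fl : Fin m → Fin d)
    (hdisj : Function.Injective (Sum.elim (Sum.elim I1 I2) Fl))
    (bstar : Fin m → ℝ) (hbstar : ∀ j, IsBit (bstar j)) :
    ∃ f : MLP d (2 * d'), f.Ternary ∧
      ∀ x : Fin d → ℝ, (∀ i, IsTernary (x i)) → (∀ j, IsBit (x (Fl j))) →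
        ((∀ j, x (Fl j) = bstar j) → ∀ t, f.eval x (I2 t) = x (I1 t)) ∧
        (¬ (∀ j, x (Fl j) = bstar j) → ∀ t, f.eval x (I2 t) = 0) ∧
        (∀ i, i ∉ Set.range I2 → f.eval x i = 0) := by
  have hI2 : Function.Injective I2 := fun s t h => by
    simpa using @hdisj (.inl (.inr s)) (.inl (.inr t)) h
  have hFl : Function.Injective Fl := fun s t h => by
    simpa using @hdisj (.inr s) (.inr t) h
  have hI1 : ∀ t j, I1 t ≠ Fl j := fun t j h => by
    simpa using @hdisj (.inl (.inl t)) (.inr j) h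
  refine ⟨copyMLP I1 I2 Fl bstar, copyMLP_ternary hFl hI1 hbstar,
    fun x hx hbit => ⟨fun hmatch t => ?_, fun hne t => ?_, fun i hi => ?_⟩⟩
  · simp only [copyMLP_eval, hI2.eq_iff, Finset.sum_ite_eq, Finset.mem_univ, if_true, hmatch,
      flag_term_eq_zero (hbstar _), Finset.sum_const_zero, add_zero]
    rcases hx (I1 t) with h | h | h <;> rw [h] <;> norm_num
  · simp only [copyMLP_eval, hI2.eq_iff, Finset.sum_ite_eq, Finset.mem_univ, if_true]
    have hle := sum_flag_term_le hbit hbstar hne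
    rw [max_eq_left, max_eq_left, sub_zero] <;>
      rcases hx (I1 t) with h | h | h <;> rw [h] <;> linarith
  · rw [copyMLP_eval]
    exact Finset.sum_eq_zero fun t _ => if_neg fun h => hi ⟨t, h.symm⟩
end

section
/- Let d ∈ ℕ, let I₁, I₂ be registers with |I₁| = |I₂| = d', let F₁,…,F_m be flags, all pairwise disjoint, let b*_1,…,b*_m ∈ {0,1} and let k ∈ {0,…,d'−1}. Then there exists an MLP f with input dimension d, hidden dimension 4d' and ternary weights such that for all x ∈ {−1,0,1}^d with x[F_j] ∈ {0,1} for all j: if x[I₁] = bin_{d'}(p) for some integer 0 ≤ p < 2^{d'} and x[F_j] = b*_j for all j, then f(x)[I₂] = bin_{d'}(max(0, p − 2^k)); if x[F_j] ≠ b*_j for some j, then f(x)[I₂] = 0; and all coordinates of f(x) at indices not in I₂ are always 0. -/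
/-- The ±1 binary representation of `i` with `r` bits, least significant bit first:
bit `s` is `1` if `⌊i / 2^s⌋` is odd and `-1` otherwise. -/
def binRep (r : ℕ) (i : ℕ) : Fin r → ℝ :=
  fun s => if (i / 2 ^ (s : ℕ)) % 2 = 1 then 1 else -1

open Finset

/-- Ternary coefficients on an injectively indexed set of coordinates extend by zero to a
ternary row vector. -/
theorem exists_ternary_row {ι : Type*} [Fintype ι] {d : ℕ} {J : ι → Fin d}
    (hJ : Function.Injective J) (c : ι → ℝ) (hc : ∀ s, IsTernary (c s)) :
    ∃ w : Fin d → ℝ, (∀ i, IsTernary (w i)) ∧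
      ∀ x : Fin d → ℝ, ∑ i, w i * x i = ∑ s, c s * x (J s) := by
  classical
  refine ⟨Function.extend J c 0, fun i => ?_, fun x => ?_⟩
  · by_cases h : ∃ s, J s = i
    · obtain ⟨s, rfl⟩ := h
      rw [hJ.extend_apply]
      exact hc s
    · rw [Function.extend_apply' _ _ _ h]
      exact Or.inr (Or.inl rfl)
  · have hsub : ∑ i ∈ univ.image J, Function.extend J c 0 i * x i
        = ∑ i, Function.extend J c 0 i * x i := by
      refine sum_subset (subset_univ _) fun i _ hi => ?_
      rw [Function.extend_apply' _ _ _ (by simpa using hi)]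
      simp
    rw [← hsub, sum_image hJ.injOn]
    simp [hJ.extend_apply]

theorem IsTernary.mul_sub_abs_nonpos {c y : ℝ} (hc : IsTernary c) (hy : IsTernary y) :
    c * y - |c| ≤ 0 := by
  rcases hc with rfl | rfl | rfl <;> rcases hy with rfl | rfl | rfl <;> norm_num

/-- On sign inputs, a ReLU neuron with ternary weights and total input bound `1` computes a
conjunction of literals. -/
theorem relu_eq_conjunction {ι : Type*} [Fintype ι] (c y : ι → ℝ)
    (hc : ∀ s, IsTernary (c s)) (hy : ∀ s, IsSign (y s)) [Decidable (∀ s, c s ≠ 0 → y s = c s)] :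
    max 0 (∑ s, (c s * y s - |c s|) + 1) = if ∀ s, c s ≠ 0 → y s = c s then 1 else 0 := by
  have hterm : ∀ s, c s * y s - |c s| ≤ 0 := fun s =>
    (hc s).mul_sub_abs_nonpos ((hy s).imp_right Or.inr)
  split_ifs with h
  · rw [sum_eq_zero]
    · norm_num
    · intro s _
      specialize h s
      rcases hc s with e | e | e <;> rw [e] at h ⊢ <;> norm_num at h ⊢ <;> rw [h] <;> norm_num
  · push Not at h
    obtain ⟨s, hs, hne⟩ := h
    have h1 : ∑ s, (c s * y s - |c s|) ≤ c s * y s - |c s| := by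
      classical
      rw [← add_sum_erase _ _ (mem_univ s)]
      have := sum_nonpos (s := univ.erase s) fun i _ => hterm i
      linarith
    have h2 : c s * y s - |c s| ≤ -2 := by
      revert hs hne
      rcases hc s with e | e | e <;> rcases hy s with e' | e' <;> norm_num [e, e']
    rw [max_eq_left]
    linarith

/-- The affine function of the flags that counts mismatches with negative sign. -/
theorem sum_flags_le_neg_one {m : ℕ} {b y : Fin m → ℝ} (hb : ∀ j, IsBit (b j))
    (hy : ∀ j, IsBit (y j)) (h : ∃ j, y j ≠ b j) : ∑ j, ((2 * b j - 1) * y j - b j) ≤ -1 := by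
  obtain ⟨j, hj⟩ := h
  rw [← add_sum_erase _ _ (mem_univ j)]
  have h1 : (2 * b j - 1) * y j - b j ≤ -1 := by
    revert hj
    rcases hb j with e | e <;> rcases hy j with e' | e' <;> norm_num [e, e']
  have h2 : ∑ j ∈ univ.erase j, ((2 * b j - 1) * y j - b j) ≤ 0 := by
    refine sum_nonpos fun i _ => ?_
    rcases hb i with e | e <;> rcases hy i with e' | e' <;> rw [e, e'] <;> norm_num
  linarith

theorem sum_flags_eq_zero {m : ℕ} {b : Fin m → ℝ} (hb : ∀ j, IsBit (b j)) :
    ∑ j, ((2 * b j - 1) * b j - b j) = 0 := by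
  refine sum_eq_zero fun j _ => ?_
  rcases hb j with e | e <;> rw [e] <;> norm_num

theorem binRep_eq_testBit (r i : ℕ) (t : Fin r) :
    binRep r i t = if i.testBit t then 1 else -1 := by
  simp [binRep, Nat.testBit_eq_decide_div_mod_eq]

/-- An MLP whose neurons are conjunctions of literals over `I1`, switched off by flag mismatch. -/
theorem exists_gated_conjunction_mlp {d d' m n : ℕ} {I1 I2 : Fin d' → Fin d} {Fl : Fin m → Fin d}
    (hdisj : Function.Injective (Sum.elim (Sum.elim I1 I2) Fl))
    {bstar : Fin m → ℝ} (hbstar : ∀ j, IsBit (bstar j))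
    (c : Fin n → Fin d' → ℝ) (hc : ∀ h s, IsTernary (c h s))
    (v : Fin d' → Fin n → ℝ) (hv : ∀ t h, IsTernary (v t h)) :
    ∃ f : MLP d n, f.Ternary ∧
      ∀ x : Fin d → ℝ, (∀ i, IsTernary (x i)) → (∀ j, IsBit (x (Fl j))) →
        ((∀ t, IsSign (x (I1 t))) → (∀ j, x (Fl j) = bstar j) →
          ∀ t, f.eval x (I2 t) =
            ∑ h, v t h * max 0 (∑ s, (c h s * x (I1 s) - |c h s|) + 1)) ∧
        ((∃ j, x (Fl j) ≠ bstar j) → ∀ t, f.eval x (I2 t) = 0) ∧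
        (∀ i, i ∉ Set.range I2 → f.eval x i = 0) := by
  have hI2 : Function.Injective I2 := fun a b h => by
    simpa using @hdisj (Sum.inl (Sum.inr a)) (Sum.inl (Sum.inr b)) (by simpa using h)
  have hJ : Function.Injective (Sum.elim I1 Fl) := by
    have e : Sum.elim I1 Fl = Sum.elim (Sum.elim I1 I2) Fl ∘ Sum.map Sum.inl id := by
      ext (_ | _) <;> rfl
    rw [e]
    exact hdisj.comp (Sum.map_injective.2 ⟨Sum.inl_injective, Function.injective_id⟩)
  choose w hw hwx using fun h => exists_ternary_row hJ
    (Sum.elim (c h) fun j => 2 * bstar j - 1) (by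
      rintro (s | j)
      · exact hc h s
      · rcases hbstar j with e | e <;> simp only [Sum.elim_inr, e, IsTernary] <;> norm_num)
  let f : MLP d n := ⟨w, fun h => 1 - ∑ s, |c h s| - ∑ j, bstar j, Function.extend I2 v 0⟩
  have hhid : ∀ x h, f.hidden x h = max 0 (∑ s, (c h s * x (I1 s) - |c h s|) + 1 +
      ∑ j, ((2 * bstar j - 1) * x (Fl j) - bstar j)) := by
    intro x h
    have := hwx h x
    simp only [Fintype.sum_sum_type, Sum.elim_inl, Sum.elim_inr] at this
    simp only [f, MLP.hidden, Matrix.mulVec, dotProduct, this, sum_sub_distrib]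
    congr 1
    ring
  have hout : ∀ x t, f.eval x (I2 t) = ∑ h, v t h * f.hidden x h := by
    intro x t
    simp only [MLP.eval, Matrix.mulVec, dotProduct]
    simp only [f, hI2.extend_apply]
  refine ⟨f, ⟨hw, fun i h => ?_⟩, fun x hx hF => ⟨fun _ hm t => ?_, fun hm t => ?_,
    fun i hi => ?_⟩⟩
  · by_cases hi : ∃ t, I2 t = i
    · obtain ⟨t, rfl⟩ := hi
      simp only [f, hI2.extend_apply]
      exact hv t h
    · simp only [f, Function.extend_apply' _ _ _ hi]
      exact Or.inr (Or.inl rfl)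
  · simp only [hout, hhid, hm, sum_flags_eq_zero hbstar, add_zero]
  · rw [hout]
    refine sum_eq_zero fun h _ => ?_
    have h1 := sum_flags_le_neg_one hbstar hF hm
    have h2 : ∑ s, (c h s * x (I1 s) - |c h s|) ≤ 0 :=
      sum_nonpos fun s _ => (hc h s).mul_sub_abs_nonpos (hx _)
    rw [hhid, max_eq_left (by linarith), mul_zero]
  · simp only [MLP.eval, Matrix.mulVec, dotProduct]
    simp only [f, Function.extend_apply' _ _ _ hi]
    simp

/-- Position `t` is where the subtraction of `2 ^ k` from `p` alters bit `t` from `1` to `0`: all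
bits at positions from `k` on (below `t`, if `k ≤ t`) vanish. -/
def IsTurningBit (k d' p t : ℕ) : Prop :=
  p.testBit t ∧ ∀ s < d', k ≤ s → (t < k ∨ s < t) → p.testBit s = false

open Classical in
theorem sign_testBit_sub_two_pow {k d' p : ℕ} (hp : p < 2 ^ d') (t : Fin d') :
    (if p.testBit t then (1 : ℝ) else -1) - 2 * (if IsTurningBit k d' p t then 1 else 0) +
        2 * ∑ s : Fin d', (if k ≤ (t : ℕ) ∧ t < s then if IsTurningBit k d' p s then 1 else 0
          else 0) =
      if (p - 2 ^ k).testBit t then 1 else -1 := by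
  rcases lt_or_ge p (2 ^ k) with hpk | hpk
  · have hhigh : ∀ s, k ≤ s → p.testBit s = false := fun s hs =>
      Nat.testBit_lt_two_pow (hpk.trans_le (Nat.pow_le_pow_right two_pos hs))
    have hturn : ∀ s, IsTurningBit k d' p s ↔ p.testBit s := fun s =>
      ⟨And.left, fun h => ⟨h, fun i _ hi _ => hhigh i hi⟩⟩
    rw [sum_eq_zero, Nat.sub_eq_zero_of_le hpk.le]
    · simp only [hturn, Nat.zero_testBit]
      split_ifs <;> norm_num at *
    · intro s _
      split_ifs with h1 h2
      · rw [hturn, hhigh s (by have : (t : ℕ) < s := h1.2; omega)] at h2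
        simp at h2
      · rfl
      · rfl
  · obtain ⟨j, q, ⟨u, rfl⟩, hq⟩ := Nat.exists_eq_two_pow_mul_odd
      (n := p / 2 ^ k) (Nat.div_pos hpk (by positivity)).ne'
    have hw : p % 2 ^ k < 2 ^ k := Nat.mod_lt _ (by positivity)
    have hpe : p = 2 ^ k * (2 ^ j * (2 * u + 1) + 0) + p % 2 ^ k := by
      rw [add_zero, ← hq, Nat.div_add_mod]
    have hpe' : p - 2 ^ k = 2 ^ k * (2 ^ j * (2 * u) + (2 ^ j - 1)) + p % 2 ^ k := by
      have h1 : 2 ^ j * (2 * u + 1) = (2 ^ j * (2 * u) + (2 ^ j - 1)) + 1 := by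
        have : 0 < 2 ^ j := by positivity
        rw [mul_add]; omega
      rw [add_zero, h1, mul_add] at hpe
      omega
    generalize p % 2 ^ k = w at hw hpe hpe'
    have hj : 0 < 2 ^ j := by positivity
    have hbit : ∀ s, p.testBit s = if s < k then w.testBit s else if s - k < j then false else
        (2 * u + 1).testBit (s - k - j) := fun s => by
      rw [hpe, Nat.testBit_two_pow_mul_add _ hw, Nat.testBit_two_pow_mul_add _ hj,
        Nat.zero_testBit]
    have hbit' : ∀ s, (p - 2 ^ k).testBit s = if s < k then w.testBit s else
        if s - k < j then true else (2 * u).testBit (s - k - j) := fun s => by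
      rw [hpe', Nat.testBit_two_pow_mul_add _ hw,
        Nat.testBit_two_pow_mul_add _ (Nat.sub_lt hj one_pos), Nat.testBit_two_pow_sub_one]
      split_ifs <;> simp_all
    have hkj : p.testBit (k + j) = true := by
      rw [hbit]; simp
    have hlt : k + j < d' := by
      by_contra h
      rw [Nat.testBit_lt_two_pow (hp.trans_le (Nat.pow_le_pow_right two_pos (not_lt.1 h)))] at hkj
      simp at hkj
    have hturn : ∀ s, IsTurningBit k d' p s ↔ s = k + j := by
      intro s
      constructor
      · rintro ⟨h1, h2⟩
        by_contra hne
        rcases lt_or_ge s (k + j) with h | h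
        · by_cases hs : s < k
          · simp [h2 (k + j) hlt (by omega) (Or.inl hs)] at hkj
          · rw [hbit, if_neg hs, if_pos (by omega)] at h1
            simp at h1
        · simp [h2 (k + j) hlt (by omega) (Or.inr (by omega))] at hkj
      · rintro rfl
        refine ⟨hkj, fun s _ h1 h2 => ?_⟩
        rw [hbit, if_neg (by omega), if_pos (by omega)]
    have hsum : ∑ s : Fin d', (if k ≤ (t : ℕ) ∧ t < s then
        if IsTurningBit k d' p s then (1 : ℝ) else 0 else 0) =
          if k ≤ (t : ℕ) ∧ (t : ℕ) < k + j then 1 else 0 := by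
      rw [sum_eq_single ⟨k + j, hlt⟩]
      · simp [hturn, Fin.lt_def]
      · intro s _ hs
        rw [if_neg (show ¬ IsTurningBit k d' p s from fun h => hs (Fin.ext ((hturn s).1 h)))]
        simp
      · simp
    rw [hsum]
    simp only [hturn, hbit, hbit']
    by_cases h1 : (t : ℕ) < k
    · rw [if_neg (show ¬ (t : ℕ) = k + j by omega), if_neg (show ¬ (k ≤ (t : ℕ) ∧ _) by omega)]
      simp [h1]
    · rcases lt_trichotomy (t : ℕ) (k + j) with h2 | h2 | h2
      · have h3 : (t : ℕ) - k < j := by omega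
        have h4 : (t : ℕ) ≠ k + j := by omega
        have h5 : k ≤ (t : ℕ) := by omega
        simp [h1, h3, h4, h5, h2]
        norm_num
      · simp [h2]
        norm_num
      · have h3 : ¬ (t : ℕ) - k < j := by omega
        have h4 : (t : ℕ) ≠ k + j := by omega
        have h5 : ¬ (k ≤ (t : ℕ) ∧ (t : ℕ) < k + j) := by omega
        obtain ⟨i, hi⟩ : ∃ i, (t : ℕ) - k - j = i + 1 := ⟨(t : ℕ) - k - j - 1, by omega⟩
        have h6 : (2 * u + 1) / 2 = u := by omega
        simp [h1, h3, h4, h5, hi, Nat.testBit_succ, h6]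

/-- Power-of-2 subtraction lemma: there is a ternary MLP with hidden dimension `4d'`
which, on admissible ternary inputs with binary flag values, writes
`bin_{d'}(max(0, p − 2^k))` to the register `I₂` whenever `I₁` holds `bin_{d'}(p)` and
all flags match the target bits; writes `0` to `I₂` when some flag does not match; and
always outputs `0` outside `I₂`. (Here `p - 2^k` is truncated natural subtraction.) -/
theorem subtract_pow2_mlp (d d' m : ℕ) (I1 I2 : Fin d' → Fin d) (Fl : Fin m → Fin d)
    (hdisj : Function.Injective (Sum.elim (Sum.elim I1 I2) Fl))
    (bstar : Fin m → ℝ) (hbstar : ∀ j, IsBit (bstar j))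
    (k : ℕ) (hk : k < d') :
    ∃ f : MLP d (4 * d'), f.Ternary ∧
      ∀ x : Fin d → ℝ, (∀ i, IsTernary (x i)) → (∀ j, IsBit (x (Fl j))) →
        (∀ p : ℕ, p < 2 ^ d' → (∀ t, x (I1 t) = binRep d' p t) →
          (∀ j, x (Fl j) = bstar j) →
          ∀ t, f.eval x (I2 t) = binRep d' (p - 2 ^ k) t) ∧
        ((∃ j, x (Fl j) ≠ bstar j) → ∀ t, f.eval x (I2 t) = 0) ∧
        (∀ i, i ∉ Set.range I2 → f.eval x i = 0) := by
  classical
  let e : Fin (4 * d') ≃ Fin 4 × Fin d' := finProdFinEquiv.symm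
  let c : Fin 4 × Fin d' → Fin d' → ℝ := fun h s =>
    if s = h.2 then (if h.1 = 1 then -1 else 1)
    else if 2 ≤ h.1 ∧ k ≤ (s : ℕ) ∧ ((h.2 : ℕ) < k ∨ s < h.2) then -1 else 0
  let v : Fin d' → Fin 4 × Fin d' → ℝ := fun t h =>
    if h.2 = t then (if h.1 = 0 then 1 else -1)
    else if 2 ≤ h.1 ∧ k ≤ (t : ℕ) ∧ t < h.2 then 1 else 0
  have hc : ∀ h s, IsTernary (c h s) := by
    intro h s
    simp only [c, IsTernary]
    split_ifs <;> simp
  have hv : ∀ t h, IsTernary (v t h) := by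
    intro t h
    simp only [v, IsTernary]
    split_ifs <;> simp
  obtain ⟨f, hf, hfx⟩ := exists_gated_conjunction_mlp hdisj hbstar (fun h => c (e h))
    (fun h => hc (e h)) (fun t h => v t (e h)) (fun t h => hv t (e h))
  refine ⟨f, hf, fun x hx hF => ⟨fun p hp hxp hm t => ?_, (hfx x hx hF).2⟩⟩
  have hsign : ∀ s, IsSign (x (I1 s)) := fun s => by
    rw [hxp, binRep_eq_testBit]
    split_ifs <;> simp [IsSign]
  have hpos : (∀ s, c (0, t) s ≠ 0 → x (I1 s) = c (0, t) s) ↔ p.testBit t = true := by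
    simp only [hxp, binRep_eq_testBit, c]
    constructor
    · intro h
      have := h t
      by_contra hb
      norm_num [hb] at this
    · intro h s
      by_cases hs : s = t
      · subst hs; simp [h]
      · simp [hs]
  have hneg : (∀ s, c (1, t) s ≠ 0 → x (I1 s) = c (1, t) s) ↔ p.testBit t = false := by
    simp only [hxp, binRep_eq_testBit, c]
    constructor
    · intro h
      have := h t
      by_contra hb
      norm_num [hb] at this
    · intro h s
      by_cases hs : s = t
      · subst hs; simp [h]
      · simp [hs]
  have hturn : ∀ a : Fin 4, 2 ≤ a → ∀ s,
      (∀ i, c (a, s) i ≠ 0 → x (I1 i) = c (a, s) i) ↔ IsTurningBit k d' p s := by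
    intro a ha s
    have ha1 : a ≠ 1 := by rintro rfl; simp at ha
    simp only [hxp, binRep_eq_testBit, c, IsTurningBit, ha, ha1, true_and, if_false]
    constructor
    · intro h
      refine ⟨?_, fun i hi h1 h2 => ?_⟩
      · have := h s
        by_contra hb
        norm_num [hb] at this
      · have := h ⟨i, hi⟩
        have hne : (⟨i, hi⟩ : Fin d') ≠ s := by
          rintro rfl
          simp at h2
          omega
        by_contra hb
        rw [if_neg hne, if_pos ⟨h1, by simpa [Fin.lt_def] using h2⟩] at this
        norm_num [hb] at this
    · rintro ⟨h1, h2⟩ i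
      by_cases hi : i = s
      · subst hi; simp [h1]
      · rw [if_neg hi]
        split_ifs with h3 h4
        · simp [h2 i i.2 h3.1 h3.2] at h4
        · simp
        · simp
        · simp
  have key : ∀ (a : Fin 4), 2 ≤ a → ∑ s, v t (a, s) * (if IsTurningBit k d' p s then 1 else 0) =
      -(if IsTurningBit k d' p t then 1 else 0) + ∑ s : Fin d', (if k ≤ (t : ℕ) ∧ t < s then
        if IsTurningBit k d' p s then 1 else 0 else 0) := by
    intro a ha
    have ha0 : a ≠ 0 := by rintro rfl; simp at ha
    rw [← Fintype.sum_ite_eq' t fun s => -(if IsTurningBit k d' p s then (1 : ℝ) else 0),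
      ← sum_add_distrib]
    refine sum_congr rfl fun s _ => ?_
    by_cases hs : s = t
    · subst hs
      simp only [v, ha0, if_true, if_false, lt_irrefl, and_false]
      ring
    · simp only [v, hs, ha, if_false, true_and]
      split_ifs <;> simp
  have hlow : ∀ (a : Fin 4), ¬ 2 ≤ a → ∀ g : Fin d' → ℝ, ∑ s, v t (a, s) * g s =
      (if a = 0 then 1 else -1) * g t := by
    intro a ha g
    rw [sum_eq_single t]
    · simp [v]
    · intro s _ hs
      simp [v, hs, ha]
    · simp
  rw [(hfx x hx hF).1 hsign hm t, binRep_eq_testBit, ← sign_testBit_sub_two_pow hp t]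
  rw [e.sum_comp fun h => v t h * max 0 (∑ s, (c h s * x (I1 s) - |c h s|) + 1)]
  simp only [relu_eq_conjunction _ _ (hc _) hsign, Fintype.sum_prod_type, Fin.sum_univ_four]
  rw [hlow 0 (by decide), hlow 1 (by decide)]
  simp only [hturn 2 (by decide), hturn 3 (by decide), key 2 (by decide), key 3 (by decide),
    hpos, hneg]
  generalize (if IsTurningBit k d' p t then (1 : ℝ) else 0) = a
  cases p.testBit t <;> simp <;> ring
end

section
/- Let Q be a finite set enumerated as q₀,…,q_{|Q|−1}, let d_Q ∈ ℕ and let enc_Q : Q → {−1,1}^{d_Q} be injective. For f : Q → Q define enc_{Q→Q}(f) := (enc_Q(f(q₀)),…,enc_Q(f(q_{|Q|−1}))) ∈ {−1,1}^{d_Q·|Q|}. Let d ≥ 2·d_Q·|Q| and let I₁, I₂ be disjoint registers in dimension d with |I₁| = |I₂| = d_Q·|Q|. Then there exists an MLP g with input dimension d and hidden dimension 2·d_Q·|Q|² such that for every x ∈ ℝ^d with x[I₁] = enc_{Q→Q}(f₁) and x[I₂] = enc_{Q→Q}(f₂) for some functions f₁, f₂ : Q → Q, it holds that g(x)[I₁]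 = enc_{Q→Q}(f₁ ∘ f₂). -/
theorem IsSign.mul_self {a : ℝ} (ha : IsSign a) : a * a = 1 := by
  rcases ha with rfl | rfl <;> norm_num

theorem IsSign.mul_le_one {a b : ℝ} (ha : IsSign a) (hb : IsSign b) : a * b ≤ 1 := by
  rcases ha with rfl | rfl <;> rcases hb with rfl | rfl <;> norm_num

theorem IsSign.mul_eq_neg_one_of_ne {a b : ℝ} (ha : IsSign a) (hb : IsSign b) (h : a ≠ b) :
    a * b = -1 := by
  rcases ha with rfl | rfl <;> rcases hb with rfl | rfl <;> simp_all

theorem sum_sign_mul_self {n : ℕ} {u : Fin n → ℝ} (hu : ∀ t, IsSign (u t)) :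
    ∑ t, u t * u t = n := by
  simp [fun t => (hu t).mul_self]

/-- The inner product of two distinct sign vectors of length `n` is at most `n - 2`. -/
theorem sum_sign_mul_le_of_ne {n : ℕ} {u v : Fin n → ℝ} (hu : ∀ t, IsSign (u t))
    (hv : ∀ t, IsSign (v t)) (huv : u ≠ v) : ∑ t, u t * v t ≤ n - 2 := by
  obtain ⟨s, hs⟩ := Function.ne_iff.mp huv
  have hle : ∑ t, u t * v t ≤ ∑ t, (1 - if t = s then (2 : ℝ) else 0) := by
    refine Finset.sum_le_sum fun t _ => ?_
    split_ifs with hts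
    · subst hts
      linarith [(hu t).mul_eq_neg_one_of_ne (hv t) hs]
    · linarith [(hu t).mul_le_one (hv t)]
  simpa [Finset.sum_sub_distrib] using hle

/-- Two ReLU units gated by the agreement of sign vectors `u` and `v` pass the sign `a` through if
`u = v` and vanish otherwise. -/
theorem relu_gate_sub {n : ℕ} {u v : Fin n → ℝ} (hu : ∀ t, IsSign (u t))
    (hv : ∀ t, IsSign (v t)) {a : ℝ} (ha : IsSign a) :
    max 0 (a + ∑ t, u t * v t + -n) - max 0 (-a + ∑ t, u t * v t + -n) =
      if u = v then a else 0 := by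
  split_ifs with huv
  · subst huv
    rw [sum_sign_mul_self hu]
    rcases ha with rfl | rfl <;> norm_num
  · have h := sum_sign_mul_le_of_ne hu hv huv
    rw [max_eq_left, max_eq_left, sub_zero] <;> rcases ha with rfl | rfl <;> linarith

/-- Composition-of-encodings lemma: with states `Q = Fin nQ` enumerated as `q₀,…,q_{nQ−1}`
and an injective encoding `encQ : Q → {−1,1}^{dQ}`, encode a function `f : Q → Q` as
`enc_{Q→Q}(f) = (encQ (f q₀), …, encQ (f q_{nQ−1}))` laid out in a register of size
`dQ·nQ`. If `d ≥ 2·dQ·nQ` and `I₁, I₂` are disjoint such registers, then there is an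
MLP `g` with hidden dimension `2·dQ·nQ²` such that whenever `x[I₁] = enc_{Q→Q}(f₁)` and
`x[I₂] = enc_{Q→Q}(f₂)`, the output satisfies `g(x)[I₁] = enc_{Q→Q}(f₁ ∘ f₂)`. -/
theorem composition_encoding_mlp (d nQ dQ : ℕ)
    (encQ : Fin nQ → Fin dQ → ℝ) (hinj : Function.Injective encQ)
    (hval : ∀ q t, IsSign (encQ q t))
    (I1 I2 : Fin nQ → Fin dQ → Fin d)
    (hdisj : Function.Injective
      (Sum.elim (fun q : Fin nQ × Fin dQ => I1 q.1 q.2)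
        (fun q : Fin nQ × Fin dQ => I2 q.1 q.2)))
    (hd : 2 * (dQ * nQ) ≤ d) :
    ∃ g : MLP d (2 * dQ * nQ ^ 2),
      ∀ x : Fin d → ℝ, ∀ f1 f2 : Fin nQ → Fin nQ,
        (∀ i k, x (I1 i k) = encQ (f1 i) k) →
        (∀ i k, x (I2 i k) = encQ (f2 i) k) →
        ∀ i k, g.eval x (I1 i k) = encQ (f1 (f2 i)) k := by
  classical
  let e : Fin (2 * dQ * nQ ^ 2) ≃ (Fin nQ × Fin dQ) × Fin nQ × Bool :=
    (Fintype.equivFinOfCardEq (by simp; ring)).symm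
  let sgn : Bool → ℝ := fun s => if s then 1 else -1
  let g : MLP d (2 * dQ * nQ ^ 2) :=
    { W1 := Matrix.of fun h =>
        Pi.single (I1 (e h).2.1 (e h).1.2) (sgn (e h).2.2) +
          ∑ t, Pi.single (I2 (e h).1.1 t) (encQ (e h).2.1 t)
      b := fun _ => -dQ
      W2 := Matrix.of fun r h => if r = I1 (e h).1.1 (e h).1.2 then sgn (e h).2.2 else 0 }
  refine ⟨g, fun x f1 f2 h1 h2 i k => ?_⟩
  have hI1 (p : Fin nQ × Fin dQ) : I1 i k = I1 p.1 p.2 ↔ (i, k) = p :=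
    ⟨fun h => Sum.inl_injective (@hdisj (Sum.inl (i, k)) (Sum.inl p) h), fun h => by rw [← h]⟩
  have hhid (h) : g.hidden x h =
      max 0 (sgn (e h).2.2 * encQ (f1 (e h).2.1) (e h).1.2 +
        ∑ t, encQ (e h).2.1 t * encQ (f2 (e h).1.1) t + -dQ) := by
    change max 0 ((Pi.single (I1 (e h).2.1 (e h).1.2) (sgn (e h).2.2) +
      ∑ t, Pi.single (I2 (e h).1.1 t) (encQ (e h).2.1 t)) ⬝ᵥ x + -dQ) = _
    simp only [add_dotProduct, sum_dotProduct, single_dotProduct, h1, h2]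
  have hsum : g.eval x (I1 i k) = ∑ p : (Fin nQ × Fin dQ) × Fin nQ × Bool,
      (if (i, k) = p.1 then sgn p.2.2 else 0) *
        max 0 (sgn p.2.2 * encQ (f1 p.2.1) p.1.2 +
          ∑ t, encQ p.2.1 t * encQ (f2 p.1.1) t + -dQ) := by
    rw [← e.sum_comp]
    simp only [MLP.eval, Matrix.mulVec, dotProduct, hhid]
    simp only [g, Matrix.of_apply, hI1]
  rw [hsum, Fintype.sum_prod_type, Finset.sum_eq_single (i, k)
    (fun p _ hp => by simp [hp.symm]) (by simp), Fintype.sum_prod_type]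
  simp only [Fintype.sum_bool, sgn, if_true, Bool.false_eq_true, if_false, one_mul, neg_one_mul,
    ← sub_eq_add_neg (max _ _)]
  simp only [relu_gate_sub (hval _) (hval _) (hval _ _), hinj.eq_iff]
  simp
end

section
/- Let H, d, d_v ∈ ℕ and let W_O^1,…,W_O^H ∈ ℝ^{d×d_v} be such that for each row index l ∈ {1,…,d} there is at most one h ∈ {1,…,H} for which row l of W_O^h is nonzero. Let o^1,…,o^H, õ^1,…,õ^H ∈ ℝ^{d_v} with ‖õ^h − o^h‖_∞ ≤ Δ for all h. Then ‖Σ_{h=1}^H W_O^h·(õ^h − o^h)‖_∞ ≤ (max_{h} ‖W_O^h‖_∞)·Δ. -/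
/-- The operator norm of a matrix induced by the sup norm: the maximum over rows of the
ℓ¹ norm of the row. -/
noncomputable def matNormInf {m n : ℕ} (W : Matrix (Fin m) (Fin n) ℝ) : ℝ :=
  sSup (Set.range fun i => ∑ j, |W i j|)

theorem row_sum_le_matNormInf {m n : ℕ} (W : Matrix (Fin m) (Fin n) ℝ) (i : Fin m) :
    ∑ j, |W i j| ≤ matNormInf W :=
  le_csSup (Set.finite_range _).bddAbove ⟨i, rfl⟩

theorem matNormInf_nonneg {m n : ℕ} (W : Matrix (Fin m) (Fin n) ℝ) : 0 ≤ matNormInf W :=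
  Real.sSup_nonneg (by rintro _ ⟨i, rfl⟩; positivity)

theorem matNormInf_of_isEmpty {m n : ℕ} [IsEmpty (Fin n)] (W : Matrix (Fin m) (Fin n) ℝ) :
    matNormInf W = 0 :=
  le_antisymm (Real.sSup_nonpos (by rintro _ ⟨i, rfl⟩; simp)) (matNormInf_nonneg W)

theorem abs_mulVec_le {m n : ℕ} (W : Matrix (Fin m) (Fin n) ℝ) {v : Fin n → ℝ} {Δ : ℝ}
    (hv : ∀ j, |v j| ≤ Δ) (i : Fin m) : |W.mulVec v i| ≤ (∑ j, |W i j|) * Δ := by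
  rw [Finset.sum_mul, Matrix.mulVec, dotProduct]
  refine (Finset.abs_sum_le_sum_abs _ _).trans (Finset.sum_le_sum fun j _ => ?_)
  rw [abs_mul]
  exact mul_le_mul_of_nonneg_left (hv j) (abs_nonneg _)

/-- Multihead output error with disjoint output projections: if for each row index `l`
at most one head `h` has a nonzero row `l` in `W_O^h`, and `‖õ^h − o^h‖_∞ ≤ Δ` for all
heads, then `‖Σ_h W_O^h (õ^h − o^h)‖_∞ ≤ (max_h ‖W_O^h‖_∞)·Δ`. -/
theorem disjoint_heads_output_error (H d dv : ℕ)
    (W : Fin H → Matrix (Fin d) (Fin dv) ℝ)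
    (hdisj : ∀ l : Fin d, ∀ h h' : Fin H,
      (∃ j, W h l j ≠ 0) → (∃ j, W h' l j ≠ 0) → h = h')
    (Δ : ℝ) (o ot : Fin H → Fin dv → ℝ)
    (ho : ∀ h j, |ot h j - o h j| ≤ Δ) :
    ∀ l : Fin d,
      |∑ h, (W h).mulVec (fun j => ot h j - o h j) l| ≤
        sSup (Set.range fun h => matNormInf (W h)) * Δ := by
  intro l
  rcases isEmpty_or_nonempty (Fin H) with hH | ⟨⟨h₁⟩⟩
  · simp [Set.range_eq_empty]
  rcases isEmpty_or_nonempty (Fin dv) with hdv | ⟨⟨j₁⟩⟩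
  · have : Nonempty (Fin H) := ⟨h₁⟩
    simp [matNormInf_of_isEmpty, Matrix.mulVec, dotProduct]
  have hΔ : 0 ≤ Δ := (abs_nonneg _).trans (ho h₁ j₁)
  have hle (h : Fin H) : matNormInf (W h) ≤ sSup (Set.range fun h => matNormInf (W h)) :=
    le_csSup (Set.finite_range _).bddAbove ⟨h, rfl⟩
  obtain ⟨h₀, hzero⟩ : ∃ h₀, ∀ h, h ≠ h₀ → ∀ j, W h l j = 0 := by
    by_cases hex : ∃ h, ∃ j, W h l j ≠ 0
    · obtain ⟨h₀, hh₀⟩ := hex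
      exact ⟨h₀, fun h hne j => by_contra fun hj => hne (hdisj l h h₀ ⟨j, hj⟩ hh₀)⟩
    · push Not at hex
      exact ⟨h₁, fun h _ => hex h⟩
  rw [Finset.sum_eq_single h₀
    (fun h _ hne => by simp [Matrix.mulVec, dotProduct, hzero h hne]) (by simp)]
  exact (abs_mulVec_le (W h₀) (ho h₀) l).trans
    (mul_le_mul_of_nonneg_right ((row_sum_le_matNormInf (W h₀) l).trans (hle h₀)) hΔ)
end
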